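/- Let k be even and let ℒ be the Laplacian tensor of a weighted k-uniform hypergraph on Fin n. Then ℒ is positive semidefinite for the Z-eigenvalue form: for every x : Fin n → ℝ, ℒ x^k ≥ 0, equivalently Σ_{e ∈ E} w e · ( Σ_{i ∈ e} (x i)^k − k · ∏_{i ∈ e} x i ) ≥ 0. -/

import Mathlib

open Finset

/-- Degree of vertex `i` in a weighted hypergraph `(E, w)`. -/
noncomputable def deg {n : ℕ} (E : Finset (Finset (Fin n))) (w : Finset (Fin n) → ℝ)
    (i : Fin n) : ℝ :=
  ∑ e ∈ E.filter (fun e => i ∈ e), w e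

/-- Adjacency tensor of a weighted `k`-uniform hypergraph. -/
noncomputable def adjT {n : ℕ} (E : Finset (Finset (Fin n))) (w : Finset (Fin n) → ℝ)
    (k : ℕ) (σ : Fin k → Fin n) : ℝ :=
  if Function.Injective σ ∧ Finset.image σ Finset.univ ∈ E then
    w (Finset.image σ Finset.univ) / (Nat.factorial (k - 1)) else 0

/-- Laplacian tensor `𝒟 - 𝒜`. -/
noncomputable def lapT {n : ℕ} (E : Finset (Finset (Fin n))) (w : Finset (Fin n) → ℝ)
    (k : ℕ) (σ : Fin k → Fin n) : ℝ :=
  (∑ i : Fin n, if σ = Function.const (Fin k) i then deg E w i else 0) - adjT E w k σ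

/-- The tuple `(i, τ₁, …, τ_{k-1})`. -/
def consT {n : ℕ} (k : ℕ) (i : Fin n) (τ : Fin (k - 1) → Fin n) : Fin k → Fin n :=
  fun t => if ht : t.val = 0 then i else τ ⟨t.val - 1, by have := t.isLt; omega⟩

/-- The Laplacian form `ℒ x^k`. -/
noncomputable def lapForm {n : ℕ} (E : Finset (Finset (Fin n))) (w : Finset (Fin n) → ℝ)
    (k : ℕ) (x : Fin n → ℝ) : ℝ :=
  ∑ σ : Fin k → Fin n, lapT E w k σ * ∏ t, x (σ t)

theorem card_filter_injective_image_eq {α : Type*} [Fintype α] [DecidableEq α] {k : ℕ}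
    {e : Finset α} (he : e.card = k) :
    (univ.filter fun σ : Fin k → α => Function.Injective σ ∧ univ.image σ = e).card
      = k.factorial := by
  have hcard : Fintype.card (Fin k ≃ e) = k.factorial := by
    rw [Fintype.card_equiv (Fintype.equivOfCardEq (by simp [he])), Fintype.card_fin]
  rw [← hcard, ← Finset.card_univ]
  symm
  refine Finset.card_bij (fun φ _ t => (φ t : α)) ?_ ?_ ?_
  · intro φ _
    simp only [mem_filter, mem_univ, true_and]
    refine ⟨Subtype.val_injective.comp φ.injective, ?_⟩
    ext a
    simp only [mem_image, mem_univ, true_and]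
    constructor
    · rintro ⟨t, rfl⟩
      exact (φ t).2
    · intro ha
      exact ⟨φ.symm ⟨a, ha⟩, by simp⟩
  · intro φ _ ψ _ h
    ext t
    exact congrFun h t
  · intro σ hσ
    simp only [mem_filter, mem_univ, true_and] at hσ
    obtain ⟨hinj, himg⟩ := hσ
    have hmem (t : Fin k) : σ t ∈ e := himg ▸ mem_image_of_mem σ (mem_univ t)
    have hbij : Function.Bijective fun t => (⟨σ t, hmem t⟩ : e) := by
      refine ⟨fun s t h => hinj (congrArg Subtype.val h), ?_⟩
      rintro ⟨a, ha⟩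
      rw [← himg] at ha
      obtain ⟨t, -, rfl⟩ := mem_image.1 ha
      exact ⟨t, rfl⟩
    exact ⟨Equiv.ofBijective _ hbij, mem_univ _, rfl⟩

theorem card_mul_prod_le_sum_pow_of_even {ι : Type*} {k : ℕ} (hk : k ≠ 0) (hkeven : Even k)
    {e : Finset ι} (he : e.card = k) (x : ι → ℝ) :
    k * ∏ i ∈ e, x i ≤ ∑ i ∈ e, x i ^ k := by
  have hk0 : (0 : ℝ) < k := by positivity
  have h := Real.geom_mean_le_arith_mean_weighted e (fun _ => (k : ℝ)⁻¹) (fun i => |x i| ^ k)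
    (fun _ _ => by positivity) (by simp [he, hk0.ne']) (fun _ _ => by positivity)
  simp only [Real.pow_rpow_inv_natCast (abs_nonneg _) hk] at h
  simp only [hkeven.pow_abs, ← mul_sum] at h
  calc k * ∏ i ∈ e, x i ≤ k * ∏ i ∈ e, |x i| := by
        rw [← abs_prod]
        gcongr
        exact le_abs_self _
    _ ≤ k * ((k : ℝ)⁻¹ * ∑ i ∈ e, x i ^ k) := by gcongr
    _ = ∑ i ∈ e, x i ^ k := by field_simp

theorem sum_deg_mul {n : ℕ} (E : Finset (Finset (Fin n))) (w : Finset (Fin n) → ℝ)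
    (f : Fin n → ℝ) : ∑ i, deg E w i * f i = ∑ e ∈ E, w e * ∑ i ∈ e, f i := by
  simp only [deg, sum_filter, sum_mul, mul_sum]
  rw [sum_comm]
  refine sum_congr rfl fun e _ => ?_
  simp [ite_mul]

theorem sum_adjT_mul_prod {n k : ℕ} (hk : k ≠ 0) {E : Finset (Finset (Fin n))}
    (w : Finset (Fin n) → ℝ) (hcard : ∀ e ∈ E, e.card = k) (x : Fin n → ℝ) :
    ∑ σ : Fin k → Fin n, adjT E w k σ * ∏ t, x (σ t)
      = ∑ e ∈ E, w e * (k * ∏ i ∈ e, x i) := by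
  have hterm (σ : Fin k → Fin n) : adjT E w k σ * ∏ t, x (σ t) =
      ∑ e ∈ E, if Function.Injective σ ∧ univ.image σ = e then
        w e / (k - 1).factorial * ∏ i ∈ e, x i else 0 := by
    by_cases hσ : Function.Injective σ
    · simp [adjT, hσ, prod_image hσ.injOn]
    · simp [adjT, hσ]
  simp only [hterm]
  rw [sum_comm]
  refine sum_congr rfl fun e he => ?_
  rw [← sum_filter, sum_const, card_filter_injective_image_eq (hcard e he), nsmul_eq_mul,
    ← Nat.mul_factorial_pred hk]
  push_cast
  field_simp

theorem lapForm_eq_sum {n k : ℕ} (hk : k ≠ 0) {E : Finset (Finset (Fin n))}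
    (w : Finset (Fin n) → ℝ) (hcard : ∀ e ∈ E, e.card = k) (x : Fin n → ℝ) :
    lapForm E w k x = ∑ e ∈ E, w e * (∑ i ∈ e, x i ^ k - k * ∏ i ∈ e, x i) := by
  have hdiag : ∑ σ : Fin k → Fin n,
      (∑ i, if σ = Function.const (Fin k) i then deg E w i else 0) * ∏ t, x (σ t)
        = ∑ i, deg E w i * x i ^ k := by
    simp only [sum_mul, ite_mul, zero_mul]
    rw [sum_comm]
    simp
  simp only [lapForm, lapT, sub_mul, sum_sub_distrib, hdiag, sum_deg_mul,
    sum_adjT_mul_prod hk w hcard, mul_sub]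

/-- for even `k` the Laplacian tensor is positive semidefinite for the
Z-eigenvalue form. -/
theorem lapForm_nonneg_of_even
    (n k : ℕ) (hn : 1 ≤ n) (hk : 2 ≤ k) (hkeven : Even k)
    (E : Finset (Finset (Fin n))) (w : Finset (Fin n) → ℝ)
    (hcard : ∀ e ∈ E, e.card = k) (hw : ∀ e ∈ E, 0 < w e) :
    ∀ x : Fin n → ℝ,
      0 ≤ lapForm E w k x ∧
      0 ≤ ∑ e ∈ E, w e * (∑ i ∈ e, x i ^ k - k * ∏ i ∈ e, x i) := by
  intro x
  have hk0 : k ≠ 0 := by omega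
  have hnonneg : 0 ≤ ∑ e ∈ E, w e * (∑ i ∈ e, x i ^ k - k * ∏ i ∈ e, x i) :=
    sum_nonneg fun e he => mul_nonneg (hw e he).le
      (sub_nonneg.2 (card_mul_prod_le_sum_pow_of_even hk0 hkeven (hcard e he) x))
  exact ⟨(lapForm_eq_sum hk0 w hcard x).symm ▸ hnonneg, hnonneg⟩
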